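/- arXiv:1904.03258 — 2 statements merged into one kernel-verified Lean document; each statement's English description precedes it below -/
import Mathlib

section
/- Let L > 0, E > 0, t > 0 and q be real numbers, and define the polynomials p₁(x) = (q/(2·E·t³))·(x⁴ − 3Lx³ + 3L²x²) and p₂(x) = (q/(2·E·t³))·(x⁴ − 3Lx³ + 3L²x² − 2L³x + L⁴), and let u(x) = p₁(x) for x < L/2 and u(x) = p₂(x) for x ≥ L/2. Then: p₁(L/2) = p₂(L/2) (so u is continuous at the hinge); (E·t³/12)·u''''(x) = q on (0, L/2) and on (L/2, L); u(0) = 0 and u'(0) = 0; u(L) = 0 and u''(L) = 0; and p₁''(L/2) = 0 and p₂''(L/2) = 0 (zero bending moment at the hinge). -/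
theorem deriv_quartic (a b c d e : ℝ) :
    deriv (fun x : ℝ => a * x ^ 4 + b * x ^ 3 + c * x ^ 2 + d * x + e) =
      fun x => 0 * x ^ 4 + 4 * a * x ^ 3 + 3 * b * x ^ 2 + 2 * c * x + d := by
  funext x
  have h := (((((hasDerivAt_pow 4 x).const_mul a).add ((hasDerivAt_pow 3 x).const_mul b)).add
    ((hasDerivAt_pow 2 x).const_mul c)).add ((hasDerivAt_id x).const_mul d)).add_const e
  refine HasDerivAt.deriv (h.congr_deriv ?_)
  push_cast
  ring

theorem iteratedDeriv_two_quartic (a b c d e x : ℝ) :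
    iteratedDeriv 2 (fun x : ℝ => a * x ^ 4 + b * x ^ 3 + c * x ^ 2 + d * x + e) x =
      12 * a * x ^ 2 + 6 * b * x + 2 * c := by
  rw [iteratedDeriv_succ', iteratedDeriv_succ', iteratedDeriv_zero, deriv_quartic, deriv_quartic]
  ring

theorem iteratedDeriv_four_quartic (a b c d e x : ℝ) :
    iteratedDeriv 4 (fun x : ℝ => a * x ^ 4 + b * x ^ 3 + c * x ^ 2 + d * x + e) x = 24 * a := by
  simp only [iteratedDeriv_succ', iteratedDeriv_zero, deriv_quartic]
  ring


/-- Propped cantilever beam with a hinge at the midspan: the piecewise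
deflection `u = p₁` on `x < L/2`, `u = p₂` on `x ≥ L/2` is continuous at the
hinge, satisfies the Euler–Bernoulli equation `(E·t³/12)·u'''' = q` on
`(0, L/2)` and `(L/2, L)`, the clamped conditions `u(0) = 0`, `u'(0) = 0`, the
simply supported conditions `u(L) = 0`, `u''(L) = 0`, and has zero bending
moment at the hinge: `p₁''(L/2) = 0` and `p₂''(L/2) = 0`. -/
theorem propped_cantilever_hinged
    (L E t q : ℝ) (hL : 0 < L) (hE : 0 < E) (ht : 0 < t)
    (p₁ p₂ u : ℝ → ℝ)
    (hp₁ : ∀ x : ℝ, p₁ x = q / (2 * E * t ^ 3) *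
      (x ^ 4 - 3 * L * x ^ 3 + 3 * L ^ 2 * x ^ 2))
    (hp₂ : ∀ x : ℝ, p₂ x = q / (2 * E * t ^ 3) *
      (x ^ 4 - 3 * L * x ^ 3 + 3 * L ^ 2 * x ^ 2 - 2 * L ^ 3 * x + L ^ 4))
    (hu : ∀ x : ℝ, u x = if x < L / 2 then p₁ x else p₂ x) :
    p₁ (L / 2) = p₂ (L / 2) ∧
    (∀ x ∈ Set.Ioo (0 : ℝ) (L / 2), E * t ^ 3 / 12 * iteratedDeriv 4 u x = q) ∧
    (∀ x ∈ Set.Ioo (L / 2) L, E * t ^ 3 / 12 * iteratedDeriv 4 u x = q) ∧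
    u 0 = 0 ∧ deriv u 0 = 0 ∧ u L = 0 ∧ iteratedDeriv 2 u L = 0 ∧
    iteratedDeriv 2 p₁ (L / 2) = 0 ∧ iteratedDeriv 2 p₂ (L / 2) = 0 := by
  set k := q / (2 * E * t ^ 3) with hk
  have hload : E * t ^ 3 / 12 * (24 * k) = q := by
    rw [hk]
    field_simp
    ring
  have hp₁' : p₁ = fun x => k * x ^ 4 + k * (-3 * L) * x ^ 3 + k * (3 * L ^ 2) * x ^ 2
      + 0 * x + 0 := by
    funext x
    rw [hp₁]
    ring
  have hp₂' : p₂ = fun x => k * x ^ 4 + k * (-3 * L) * x ^ 3 + k * (3 * L ^ 2) * x ^ 2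
      + k * (-2 * L ^ 3) * x + k * L ^ 4 := by
    funext x
    rw [hp₂]
    ring
  have hleft : ∀ x < L / 2, u =ᶠ[nhds x] p₁ := fun x hx => by
    filter_upwards [Iio_mem_nhds hx] with y hy
    rw [hu, if_pos (Set.mem_Iio.1 hy)]
  have hright : ∀ x, L / 2 < x → u =ᶠ[nhds x] p₂ := fun x hx => by
    filter_upwards [Ioi_mem_nhds hx] with y hy
    rw [hu, if_neg (not_lt.2 (le_of_lt (Set.mem_Ioi.1 hy)))]
  have h0 : 0 < L / 2 := by linarith
  have h1 : L / 2 < L := by linarith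
  refine ⟨?_, fun x hx => ?_, fun x hx => ?_, ?_, ?_, ?_, ?_, ?_, ?_⟩
  · rw [hp₁, hp₂]
    ring
  · rw [(hleft x hx.2).iteratedDeriv_eq, hp₁', iteratedDeriv_four_quartic, hload]
  · rw [(hright x hx.1).iteratedDeriv_eq, hp₂', iteratedDeriv_four_quartic, hload]
  · rw [(hleft 0 h0).eq_of_nhds, hp₁]
    ring
  · rw [(hleft 0 h0).deriv_eq, hp₁', deriv_quartic]
    ring
  · rw [(hright L h1).eq_of_nhds, hp₂]
    ring
  · rw [(hright L h1).iteratedDeriv_eq, hp₂', iteratedDeriv_two_quartic]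
    ring
  · rw [hp₁', iteratedDeriv_two_quartic]
    ring
  · rw [hp₂', iteratedDeriv_two_quartic]
    ring
end

section
/- Let N be the cardinal cubic B-spline, B_k(η) = N(4η + 4 − k) for k = 1, …, 7, w̃₁(η) = B₁(η) + B₂(η) + B₃(η) + B₄(η)/2 and w̃₂(η) = B₄(η)/2 + B₅(η) + B₆(η) + B₇(η). Then w̃₁ vanishes to second order at η = 1, i.e. w̃₁(1) = 0, w̃₁'(1) = 0 and w̃₁''(1) = 0, and symmetrically w̃₂(0) = 0, w̃₂'(0) = 0 and w̃₂''(0) = 0. Hence each C² blending function, together with its first and second derivatives, vanishes at the boundary of its chart domain, as required for the blended manifold basis functions to be C² continuous. -/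
/-- The cardinal cubic B-spline. -/
noncomputable def cubicBSpline (t : ℝ) : ℝ :=
  if 0 ≤ t ∧ t < 1 then t ^ 3 / 6
  else if 1 ≤ t ∧ t < 2 then (-3 * t ^ 3 + 12 * t ^ 2 - 12 * t + 4) / 6
  else if 2 ≤ t ∧ t < 3 then (3 * t ^ 3 - 24 * t ^ 2 + 60 * t - 44) / 6
  else if 3 ≤ t ∧ t < 4 then (4 - t) ^ 3 / 6
  else 0

/-- The cubic B-splines over a knot vector with uniform knot distance `1/4`:
`B_k(η) = N(4η + 4 − k)` for `k = 1, …, 7`. -/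
noncomputable def bspline (k : ℕ) (η : ℝ) : ℝ :=
  cubicBSpline (4 * η + 4 - k)

/-- First blending function `w̃₁ = B₁ + B₂ + B₃ + B₄/2`. -/
noncomputable def blend₁ (η : ℝ) : ℝ :=
  bspline 1 η + bspline 2 η + bspline 3 η + bspline 4 η / 2

/-- Second blending function `w̃₂ = B₄/2 + B₅ + B₆ + B₇`. -/
noncomputable def blend₂ (η : ℝ) : ℝ :=
  bspline 4 η / 2 + bspline 5 η + bspline 6 η + bspline 7 η

open Filter Topology in
/-- Truncated powers of exponent at least two are differentiable everywhere. -/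
theorem hasDerivAt_max_zero_pow (n : ℕ) (x : ℝ) :
    HasDerivAt (fun y : ℝ => max y 0 ^ (n + 2)) ((n + 2) * max x 0 ^ (n + 1)) x := by
  rcases lt_trichotomy x 0 with hx | rfl | hx
  · have h : (fun y : ℝ => max y 0 ^ (n + 2)) =ᶠ[𝓝 x] fun _ => 0 := by
      filter_upwards [gt_mem_nhds hx] with y hy
      simp [max_eq_right hy.le]
    simpa [max_eq_right hx.le] using (hasDerivAt_const x (0 : ℝ)).congr_of_eventuallyEq h
  · rw [hasDerivAt_iff_tendsto_slope_zero]
    have hc : Continuous fun t : ℝ => max t 0 ^ (n + 1) := by fun_prop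
    have ht : Tendsto (fun t : ℝ => max t 0 ^ (n + 1)) (𝓝[≠] 0) (𝓝 0) := by
      simpa using hc.continuousAt.tendsto.mono_left (nhdsWithin_le_nhds (a := (0 : ℝ)))
    simp only [max_self, ne_eq, Nat.add_eq_zero_iff, one_ne_zero, and_false,
      not_false_eq_true, zero_pow, mul_zero]
    refine ht.congr' ?_
    filter_upwards [self_mem_nhdsWithin] with t ht
    have ht : t ≠ 0 := ht
    rcases le_total t 0 with h | h
    · simp [max_eq_right h]
    · simp only [zero_add, max_eq_left h, smul_eq_mul]
      simp
      field_simp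
      ring
  · have h : (fun y : ℝ => max y 0 ^ (n + 2)) =ᶠ[𝓝 x] fun y => y ^ (n + 2) := by
      filter_upwards [lt_mem_nhds hx] with y hy
      rw [max_eq_left hy.le]
    simpa [max_eq_left hx.le] using (hasDerivAt_pow (n + 2) x).congr_of_eventuallyEq h

/-- A function that agrees near `a` with a truncated cube of an affine function vanishing at `a`
vanishes to second order at `a`. -/
theorem vanish_second_order_of_eventuallyEq_max_zero_cube {f : ℝ → ℝ} {a c m b : ℝ}
    (hab : m * a + b = 0) (hf : f =ᶠ[nhds a] fun x => c * max (m * x + b) 0 ^ 3) :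
    f a = 0 ∧ deriv f a = 0 ∧ iteratedDeriv 2 f a = 0 := by
  have haff (x : ℝ) : HasDerivAt (fun x => m * x + b) m x := by
    simpa using ((hasDerivAt_id x).const_mul m).add_const b
  have h1 : deriv (fun x => c * max (m * x + b) 0 ^ 3) =
      fun x => c * (3 * max (m * x + b) 0 ^ 2 * m) := by
    ext x
    have := (((hasDerivAt_max_zero_pow 1 (m * x + b)).comp x (haff x)).const_mul c).deriv
    norm_num [Function.comp_def] at this ⊢
    exact this
  have h2 : HasDerivAt (fun x => c * (3 * max (m * x + b) 0 ^ 2 * m)) 0 a := by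
    have := ((((hasDerivAt_max_zero_pow 0 (m * a + b)).comp a (haff a)).const_mul
      (3 : ℝ)).mul_const m).const_mul c
    simpa [hab, Function.comp_def] using this
  refine ⟨by simp [hf.eq_of_nhds, hab], by simp [hf.deriv_eq, h1, hab], ?_⟩
  rw [hf.iteratedDeriv_eq, iteratedDeriv_succ, iteratedDeriv_one, h1, h2.deriv]

theorem cubicBSpline_of_lt_one {t : ℝ} (ht : t < 1) : cubicBSpline t = max t 0 ^ 3 / 6 := by
  unfold cubicBSpline
  split_ifs <;> grind

theorem cubicBSpline_of_three_le {t : ℝ} (ht : 3 ≤ t) :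
    cubicBSpline t = max (4 - t) 0 ^ 3 / 6 := by
  unfold cubicBSpline
  split_ifs <;> grind

theorem cubicBSpline_of_nonpos {t : ℝ} (ht : t ≤ 0) : cubicBSpline t = 0 := by
  simp [cubicBSpline_of_lt_one (ht.trans_lt one_pos), max_eq_right ht]

theorem cubicBSpline_of_four_le {t : ℝ} (ht : 4 ≤ t) : cubicBSpline t = 0 := by
  simp [cubicBSpline_of_three_le (show 3 ≤ t by linarith), max_eq_right (sub_nonpos.2 ht)]

theorem blend₁_eventuallyEq_nhds_one :
    blend₁ =ᶠ[nhds 1] fun η => 1 / 12 * max (-4 * η + 4) 0 ^ 3 := by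
  filter_upwards [lt_mem_nhds (show (3 / 4 : ℝ) < 1 by norm_num)] with η hη
  simp only [blend₁, bspline]
  push_cast
  rw [cubicBSpline_of_four_le (by linarith), cubicBSpline_of_four_le (by linarith),
    cubicBSpline_of_four_le (by linarith), cubicBSpline_of_three_le (by linarith),
    show 4 - (4 * η + 4 - 4) = -4 * η + 4 by ring]
  ring

theorem blend₂_eventuallyEq_nhds_zero :
    blend₂ =ᶠ[nhds 0] fun η => 1 / 12 * max (4 * η + 0) 0 ^ 3 := by
  filter_upwards [gt_mem_nhds (show (0 : ℝ) < 1 / 4 by norm_num)] with η hη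
  simp only [blend₂, bspline]
  push_cast
  rw [cubicBSpline_of_lt_one (by linarith), cubicBSpline_of_nonpos (by linarith),
    cubicBSpline_of_nonpos (by linarith), cubicBSpline_of_nonpos (by linarith),
    show 4 * η + 4 - 4 = 4 * η + 0 by ring]
  ring

/-- Each C² blending function vanishes to second order at the boundary of its
chart domain: `w̃₁(1) = w̃₁'(1) = w̃₁''(1) = 0` and
`w̃₂(0) = w̃₂'(0) = w̃₂''(0) = 0`, as required for the blended manifold basis
functions to be C² continuous. -/
theorem blend_vanish_second_order_at_boundary :
    blend₁ 1 = 0 ∧ deriv blend₁ 1 = 0 ∧ iteratedDeriv 2 blend₁ 1 = 0 ∧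
    blend₂ 0 = 0 ∧ deriv blend₂ 0 = 0 ∧ iteratedDeriv 2 blend₂ 0 = 0 := by
  obtain ⟨h₁, h₂, h₃⟩ := vanish_second_order_of_eventuallyEq_max_zero_cube (by norm_num)
    blend₁_eventuallyEq_nhds_one
  exact ⟨h₁, h₂, h₃, vanish_second_order_of_eventuallyEq_max_zero_cube (by norm_num)
    blend₂_eventuallyEq_nhds_zero⟩
end
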